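/- arXiv:1612.00235 — 2 statements merged into one kernel-verified Lean document; each statement's English description precedes it below -/
import Mathlib

section
/- Let k ∈ ℕ, k ≥ 1, and let δ > 0. Then there exist a continuous doubly positive function f : ℝ → ℝ with ∫_{-1}^{1} f(x) dx > 0 and a real number a such that ∫_{a-k}^{a+k} f(x) dx ≥ (2k − δ) · ∫_{-1}^{1} f(x) dx. (In particular C(k) ≥ 2k, where C(ℓ) is the supremum over not identically zero doubly positive f and over a ∈ ℝ of ∫_{a-ℓ}^{a+ℓ} f / ∫_{-1}^{1} f.) -/
open MeasureTheory Real

/-- A function `f : ℝ → ℝ` is positive definite if for every `n`, all points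
`x 0, …, x (n-1)` and complex scalars `c 0, …, c (n-1)`, the real part of
`∑ i ∑ j, c i * conj (c j) * f (x i - x j)` is nonnegative. -/
def IsPosDefFn (f : ℝ → ℝ) : Prop :=
  ∀ (n : ℕ) (x : Fin n → ℝ) (c : Fin n → ℂ),
    0 ≤ (∑ i, ∑ j, c i * (starRingEnd ℂ) (c j) * (f (x i - x j) : ℂ)).re

/-- A function is doubly positive if it is positive definite and pointwise nonnegative. -/
def IsDoublyPos (f : ℝ → ℝ) : Prop :=
  IsPosDefFn f ∧ ∀ x, 0 ≤ f x

lemma isPosDefFn_one : IsPosDefFn (fun _ => 1) := by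
  intro n x c
  have h : (∑ i, ∑ j, c i * (starRingEnd ℂ) (c j) * ((1 : ℝ) : ℂ)) =
      ((Complex.normSq (∑ i, c i) : ℝ) : ℂ) := by
    rw [← Complex.mul_conj, map_sum, Finset.sum_mul_sum]
    simp
  rw [h, Complex.ofReal_re]
  exact Complex.normSq_nonneg _

lemma IsPosDefFn.add {f g : ℝ → ℝ} (hf : IsPosDefFn f) (hg : IsPosDefFn g) :
    IsPosDefFn (fun x => f x + g x) := by
  intro n x c
  have h := add_nonneg (hf n x c) (hg n x c)
  rw [← Complex.add_re, ← Finset.sum_add_distrib] at h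
  refine h.trans_eq (congrArg Complex.re (Finset.sum_congr rfl fun i _ => ?_))
  rw [← Finset.sum_add_distrib]
  refine Finset.sum_congr rfl fun j _ => ?_
  push_cast
  ring

lemma IsPosDefFn.const_mul {f : ℝ → ℝ} (hf : IsPosDefFn f) {a : ℝ} (ha : 0 ≤ a) :
    IsPosDefFn (fun x => a * f x) := by
  intro n x c
  have h := mul_nonneg ha (hf n x c)
  rw [← Complex.re_ofReal_mul, Finset.mul_sum] at h
  refine h.trans_eq (congrArg Complex.re (Finset.sum_congr rfl fun i _ => ?_))
  rw [Finset.mul_sum]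
  refine Finset.sum_congr rfl fun j _ => ?_
  push_cast
  ring

lemma IsPosDefFn.mul_cos {f : ℝ → ℝ} (hf : IsPosDefFn f) (ω : ℝ) :
    IsPosDefFn (fun x => f x * cos (ω * x)) := by
  intro n x c
  have h := add_nonneg (hf n x fun i => c i * (cos (ω * x i) : ℝ))
    (hf n x fun i => c i * (sin (ω * x i) : ℝ))
  rw [← Complex.add_re, ← Finset.sum_add_distrib] at h
  refine h.trans_eq (congrArg Complex.re (Finset.sum_congr rfl fun i _ => ?_))
  rw [← Finset.sum_add_distrib]
  refine Finset.sum_congr rfl fun j _ => ?_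
  simp only [mul_sub, cos_sub, map_mul, Complex.conj_ofReal]
  push_cast
  ring

/-- The function `cos (ω x / 2) ^ (2 n)`, written through the double angle. -/
noncomputable def cosPow (ω : ℝ) (n : ℕ) (x : ℝ) : ℝ := ((1 + cos (ω * x)) / 2) ^ n

lemma cosPow_base_nonneg (y : ℝ) : 0 ≤ (1 + cos y) / 2 := by
  linarith [neg_one_le_cos y]

lemma isDoublyPos_cosPow (ω : ℝ) (n : ℕ) : IsDoublyPos (cosPow ω n) := by
  refine ⟨?_, fun x => pow_nonneg (cosPow_base_nonneg _) n⟩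
  induction n with
  | zero =>
    convert isPosDefFn_one using 1
    ext x
    simp [cosPow]
  | succ n ih =>
    convert (ih.add (ih.mul_cos ω)).const_mul (a := 1 / 2) (by norm_num) using 1
    ext x
    simp only [cosPow, pow_succ]
    ring

lemma continuous_cosPow (ω : ℝ) (n : ℕ) : Continuous (cosPow ω n) := by
  unfold cosPow
  fun_prop

lemma cosPow_neg (ω : ℝ) (n : ℕ) (x : ℝ) : cosPow ω n (-x) = cosPow ω n x := by
  simp [cosPow]

lemma periodic_cosPow {p : ℝ} (hp : p ≠ 0) (n : ℕ) :
    Function.Periodic (cosPow (2 * π / p) n) p := by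
  intro x
  have h : 2 * π / p * (x + p) = 2 * π / p * x + 2 * π := by field_simp
  rw [cosPow, cosPow, h, cos_add_two_pi]

lemma cosPow_le_of_mem_Icc {p r x : ℝ} (hp : 0 < p) (hr : 0 ≤ r) (hx : x ∈ Set.Icc r (p - r))
    (n : ℕ) : cosPow (2 * π / p) n x ≤ cosPow (2 * π / p) n r := by
  wlog hxp : x ≤ p / 2 generalizing x
  · have h := this (x := p - x) ⟨by linarith [hx.2], by linarith [hx.1]⟩ (by linarith)
    rwa [(periodic_cosPow hp.ne' n).sub_eq', cosPow_neg] at h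
  have hω : 0 < 2 * π / p := by positivity
  have h1 : 2 * π / p * x ≤ π := by
    calc 2 * π / p * x ≤ 2 * π / p * (p / 2) := by gcongr
      _ = π := by field_simp
  have h2 : cos (2 * π / p * x) ≤ cos (2 * π / p * r) :=
    cos_le_cos_of_nonneg_of_le_pi (by positivity) h1 (by gcongr; exact hx.1)
  exact pow_le_pow_left₀ (cosPow_base_nonneg _) (by linarith) n

lemma cosPow_le_of_abs_le {p s x : ℝ} (hp : 0 < p) (hs : s ≤ p / 2) (hx : |x| ≤ s)
    (n : ℕ) : cosPow (2 * π / p) n s ≤ cosPow (2 * π / p) n x := by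
  have h0 : cosPow (2 * π / p) n |x| = cosPow (2 * π / p) n x := by
    rcases abs_choice x with h | h <;> rw [h]
    exact cosPow_neg _ _ _
  rw [← h0]
  exact cosPow_le_of_mem_Icc hp (abs_nonneg x) ⟨hx, by linarith⟩ n

/-- For large `n`, the mass of `cosPow` on `[r, p - r]` is negligible compared to the one near
the origin. -/
lemma exists_cosPow_le {p r ε : ℝ} (hr : 0 < r) (hrp : r ≤ p / 2) (hε : 0 < ε) :
    ∃ n, cosPow (2 * π / p) n r ≤ ε * cosPow (2 * π / p) n (r / 2) := by
  have hp : 0 < p := by linarith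
  have h1 : 2 * π / p * r ≤ π := by
    calc 2 * π / p * r ≤ 2 * π / p * (p / 2) := by gcongr
      _ = π := by field_simp
  have hlt : cos (2 * π / p * r) < cos (2 * π / p * (r / 2)) :=
    cos_lt_cos_of_nonneg_of_le_pi (by positivity) h1 (by gcongr; linarith)
  set u := (1 + cos (2 * π / p * r)) / 2 with hu
  set v := (1 + cos (2 * π / p * (r / 2))) / 2 with hv
  have hu0 : 0 ≤ u := cosPow_base_nonneg _
  have huv : u < v := by linarith
  have hv0 : 0 < v := hu0.trans_lt huv
  obtain ⟨n, hn⟩ := exists_pow_lt_of_lt_one hε ((div_lt_one hv0).2 huv)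
  refine ⟨n, ?_⟩
  rw [div_pow, div_lt_iff₀ (by positivity)] at hn
  exact hn.le

lemma integral_mono_interval_of_nonneg {f : ℝ → ℝ} (hf : Continuous f) (h0 : ∀ x, 0 ≤ f x)
    {a b c d : ℝ} (hca : c ≤ a) (hab : a ≤ b) (hbd : b ≤ d) :
    ∫ x in a..b, f x ≤ ∫ x in c..d, f x :=
  intervalIntegral.integral_mono_interval hca hab hbd (Filter.Eventually.of_forall h0)
    (hf.intervalIntegrable _ _)

theorem lower_bound_C (k : ℕ) (hk : 1 ≤ k) (δ : ℝ) (hδ : 0 < δ) :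
    ∃ (f : ℝ → ℝ) (a : ℝ), Continuous f ∧ IsDoublyPos f ∧ (0 < ∫ x in (-1 : ℝ)..1, f x) ∧
      (2 * (k : ℝ) - δ) * ∫ x in (-1 : ℝ)..1, f x ≤
        ∫ x in (a - (k : ℝ))..(a + (k : ℝ)), f x := by
  have hk' : (1 : ℝ) ≤ k := by exact_mod_cast hk
  obtain ⟨r, hr⟩ : ∃ r : ℝ, r = 1 / (4 * k) := ⟨_, rfl⟩
  have hrk : r * k = 1 / 4 := by rw [hr]; field_simp
  have hr0 : 0 < r := by rw [hr]; positivity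
  have hr1 : r ≤ 1 / 4 := by nlinarith
  obtain ⟨p, hp⟩ : ∃ p : ℝ, p = 1 + r := ⟨_, rfl⟩
  have hp0 : 0 < p := by linarith
  obtain ⟨n, hn⟩ := exists_cosPow_le (p := p) (ε := δ * r / (4 * k)) hr0 (by linarith)
    (by positivity)
  have hper := periodic_cosPow hp0.ne' n
  have hle : ∀ x ∈ Set.Icc r 1, cosPow (2 * π / p) n x ≤ cosPow (2 * π / p) n r :=
    fun x hx => cosPow_le_of_mem_Icc hp0 hr0.le ⟨hx.1, by linarith [hx.2]⟩ n
  have hge : ∀ x ∈ Set.Icc (-(r / 2)) (r / 2),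
      cosPow (2 * π / p) n (r / 2) ≤ cosPow (2 * π / p) n x :=
    fun x hx => cosPow_le_of_abs_le hp0 (by linarith) (abs_le.2 hx) n
  have hpos : 0 < cosPow (2 * π / p) n (r / 2) := by
    refine pow_pos ?_ n
    have : 0 < cos (2 * π / p * (r / 2)) := by
      have h0 : 0 ≤ 2 * π / p * (r / 2) := by positivity
      refine cos_pos_of_mem_Ioo ⟨by linarith [pi_pos], ?_⟩
      rw [show 2 * π / p * (r / 2) = π * (r / p) by ring]
      have : r / p < 1 / 2 := by rw [div_lt_iff₀ hp0]; linarith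
      nlinarith [pi_pos]
    linarith
  have hcont := continuous_cosPow (2 * π / p) n
  have hdp := isDoublyPos_cosPow (2 * π / p) n
  have heven := cosPow_neg (2 * π / p) n
  generalize cosPow (2 * π / p) n = f at *
  have hint : ∀ a b, IntervalIntegrable f volume a b := hcont.intervalIntegrable
  have hA : r * f (r / 2) ≤ ∫ x in (-r)..r, f x := by
    calc r * f (r / 2) = ∫ x in (-(r / 2))..(r / 2), f (r / 2) := by
          rw [intervalIntegral.integral_const, smul_eq_mul]; ring
      _ ≤ ∫ x in (-(r / 2))..(r / 2), f x :=
          intervalIntegral.integral_mono_on (by linarith) (by simp) (hint _ _) hge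
      _ ≤ _ := integral_mono_interval_of_nonneg hcont hdp.2 (by linarith) (by linarith)
          (by linarith)
  have hB : ∫ x in r..1, f x ≤ f r := by
    calc ∫ x in r..1, f x ≤ ∫ x in r..1, f r :=
          intervalIntegral.integral_mono_on (by linarith) (hint _ _) (by simp) hle
      _ = (1 - r) * f r := by rw [intervalIntegral.integral_const, smul_eq_mul]
      _ ≤ f r := by nlinarith [hdp.2 r]
  have hB' : ∫ x in (-1)..(-r), f x = ∫ x in r..1, f x := by
    rw [← intervalIntegral.integral_comp_neg]
    simp only [heven]
  have hS : ∫ x in (-1 : ℝ)..1, f x = (∫ x in (-r)..r, f x) + 2 * ∫ x in r..1, f x := by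
    rw [← intervalIntegral.integral_add_adjacent_intervals (hint (-1) (-r)) (hint (-r) 1),
      ← intervalIntegral.integral_add_adjacent_intervals (hint (-r) r) (hint r 1), hB']
    ring
  have hB0 : 0 ≤ ∫ x in r..1, f x :=
    intervalIntegral.integral_nonneg (by linarith) fun x _ => hdp.2 x
  have hA0 : 0 < ∫ x in (-r)..r, f x := lt_of_lt_of_le (by positivity) hA
  have hperiod : ∫ x in (-r)..r, f x ≤ ∫ x in (1 : ℝ)..(1 + p), f x := by
    rw [hper.intervalIntegral_add_eq 1 (-r)]
    exact integral_mono_interval_of_nonneg hcont hdp.2 le_rfl (by linarith) (by linarith)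
  have hmany : ∫ x in (1 : ℝ)..(1 + (2 * k - 1) * p), f x
      = (2 * k - 1) * ∫ x in (1 : ℝ)..(1 + p), f x := by
    have h := hper.intervalIntegral_add_zsmul_eq (2 * k - 1) 1 hint
    simpa [zsmul_eq_mul] using h
  have hlast : ∫ x in (-r)..r, f x ≤ ∫ x in (1 + (2 * k - 1) * p)..(2 * k + 1), f x := by
    have hshift : ∫ x in (-r)..r, f x
        = ∫ x in (-r + (2 * k : ℕ) * p)..(r + (2 * k : ℕ) * p), f x := by
      rw [← intervalIntegral.integral_comp_add_right]
      exact intervalIntegral.integral_congr fun x _ => ((hper.nat_mul (2 * k)) x).symm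
    rw [hshift]
    push_cast
    refine integral_mono_interval_of_nonneg hcont hdp.2 ?_ ?_ ?_ <;> subst hp <;> nlinarith
  have htotal : 2 * k * ∫ x in (-r)..r, f x ≤ ∫ x in (1 : ℝ)..(2 * k + 1), f x := by
    rw [← intervalIntegral.integral_add_adjacent_intervals (hint 1 (1 + (2 * k - 1) * p))
      (hint _ (2 * k + 1)), hmany]
    nlinarith
  refine ⟨f, k + 1, hcont, hdp, by rw [hS]; positivity, ?_⟩
  rw [show (k : ℝ) + 1 - k = 1 by ring, show (k : ℝ) + 1 + k = 2 * k + 1 by ring, hS]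
  refine le_trans ?_ htotal
  have hsmall : 4 * k * f r ≤ δ * (r * f (r / 2)) := by
    calc 4 * k * f r ≤ 4 * k * (δ * r / (4 * k) * f (r / 2)) := by gcongr
      _ = δ * (r * f (r / 2)) := by field_simp
  have h1 : 4 * k * (∫ x in r..1, f x) ≤ 4 * k * f r := by gcongr
  have h2 : δ * (r * f (r / 2)) ≤ δ * ∫ x in (-r)..r, f x := by gcongr
  nlinarith [mul_nonneg hδ.le hB0]
end

section
/- Let ℓ > 0, A, B ∈ ℝ, and let H : ℝ → ℝ be a continuous, integrable, positive definite function satisfying H(x) ≤ A·χ_{[-1,1]}(x) − B·χ_{[-ℓ,ℓ]}(x) for all x ∈ ℝ. Then for every continuous doubly positive function f : ℝ → ℝ one has B · ∫_{-ℓ}^{ℓ} f(x) dx ≤ A · ∫_{-1}^{1} f(x) dx. -/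
open MeasureTheory Real

/-- Characteristic function of the closed interval `[s, t]`. -/
noncomputable def chi (s t x : ℝ) : ℝ := if x ∈ Set.Icc s t then 1 else 0

open Filter Topology ProbabilityTheory

open scoped Matrix

/-- The even part `x ↦ (f x + f (-x)) / 2` of a function on `ℝ`. -/
noncomputable def evenPart (f : ℝ → ℝ) (x : ℝ) : ℝ := (f x + f (-x)) / 2

theorem evenPart_neg (f : ℝ → ℝ) (x : ℝ) : evenPart f (-x) = evenPart f x := by
  simp [evenPart, add_comm]

theorem continuous_evenPart {f : ℝ → ℝ} (hf : Continuous f) : Continuous (evenPart f) := by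
  unfold evenPart
  fun_prop

theorem integrable_evenPart {f : ℝ → ℝ} (hf : Integrable f) : Integrable (evenPart f) :=
  (hf.add hf.comp_neg).div_const 2

theorem intervalIntegral_evenPart {f : ℝ → ℝ} (hf : Continuous f) (a : ℝ) :
    ∫ x in (-a)..a, evenPart f x = ∫ x in (-a)..a, f x := by
  have hneg : ∫ x in (-a)..a, f (-x) = ∫ x in (-a)..a, f x := by
    simp [intervalIntegral.integral_comp_neg]
  simp only [evenPart]
  have hfneg : Continuous fun x => f (-x) := hf.comp continuous_neg
  rw [intervalIntegral.integral_div, intervalIntegral.integral_add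
    (hf.intervalIntegrable _ _) (hfneg.intervalIntegrable _ _), hneg]
  ring

theorem IsPosDefFn.sum_nonneg {f : ℝ → ℝ} (hf : IsPosDefFn f) {n : ℕ} (x c : Fin n → ℝ) :
    0 ≤ ∑ i, ∑ j, c i * c j * f (x i - x j) := by
  simpa [← Complex.ofReal_mul] using hf n x fun i => (c i : ℂ)

theorem IsPosDefFn.posSemidef_evenPart {f : ℝ → ℝ} (hf : IsPosDefFn f) {n : ℕ} (x : Fin n → ℝ) :
    (Matrix.of fun i j => evenPart f (x i - x j)).PosSemidef := by
  refine .of_dotProduct_mulVec_nonneg ?_ fun c => ?_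
  · ext i j
    simp [← evenPart_neg f (x i - x j)]
  · have hneg : 0 ≤ ∑ i, ∑ j, c i * c j * f (-(x i - x j)) := by
      rw [Finset.sum_comm]
      simpa [mul_comm] using hf.sum_nonneg x c
    have hsum := add_nonneg (hf.sum_nonneg x c) hneg
    simp only [← Finset.sum_add_distrib, ← mul_add] at hsum
    have heq : star c ⬝ᵥ (Matrix.of fun i j => evenPart f (x i - x j)) *ᵥ c =
        (∑ i, ∑ j, c i * c j * (f (x i - x j) + f (-(x i - x j)))) / 2 := by
      simp only [dotProduct, Matrix.mulVec, Matrix.of_apply, Finset.mul_sum, Finset.sum_div,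
        evenPart, Pi.star_apply, star_trivial]
      exact Finset.sum_congr rfl fun i _ => Finset.sum_congr rfl fun j _ => by ring
    rw [heq]
    positivity

theorem IsPosDefFn.abs_evenPart_le {f : ℝ → ℝ} (hf : IsPosDefFn f) (x : ℝ) :
    |evenPart f x| ≤ f 0 := by
  have hplus := hf.sum_nonneg ![x, 0] ![1, 1]
  have hminus := hf.sum_nonneg ![x, 0] ![1, -1]
  simp [Fin.sum_univ_two] at hplus hminus
  rw [abs_le, evenPart]
  constructor <;> linarith

/-- A consequence of the Schur product theorem. -/
theorem IsPosDefFn.sum_evenPart_mul_evenPart_nonneg {f h : ℝ → ℝ} (hf : IsPosDefFn f)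
    (hh : IsPosDefFn h) {n : ℕ} (x : Fin n → ℝ) :
    0 ≤ ∑ i, ∑ j, evenPart f (x i - x j) * evenPart h (x i - x j) := by
  simpa [dotProduct, Matrix.mulVec] using
    ((hf.posSemidef_evenPart x).hadamard (hh.posSemidef_evenPart x)).dotProduct_mulVec_nonneg 1

theorem integral_pi_eval_eval {n : ℕ} (μ : Measure ℝ) [IsProbabilityMeasure μ]
    {k : ℝ → ℝ → ℝ} (hk : Continuous fun p : ℝ × ℝ => k p.1 p.2) {i j : Fin n} (hij : i ≠ j) :
    ∫ x, k (x i) (x j) ∂(Measure.pi fun _ : Fin n => μ) = ∫ p, k p.1 p.2 ∂(μ.prod μ) := by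
  have hind : (fun x : Fin n → ℝ => x i) ⟂ᵢ[Measure.pi fun _ : Fin n => μ] fun x => x j :=
    (iIndepFun_pi (X := fun _ : Fin n => (id : ℝ → ℝ)) fun _ => aemeasurable_id).indepFun hij
  have hmap := (indepFun_iff_map_prod_eq_prod_map_map (measurable_pi_apply i).aemeasurable
    (measurable_pi_apply j).aemeasurable).1 hind
  rw [(measurePreserving_eval (fun _ : Fin n => μ) i).map_eq,
    (measurePreserving_eval (fun _ : Fin n => μ) j).map_eq] at hmap
  rw [← hmap, integral_map
    ((measurable_pi_apply i).prodMk (measurable_pi_apply j)).aemeasurable hk.aestronglyMeasurable]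

/-- If all sums `∑ i, ∑ j, k (x i) (x j)` of a bounded continuous kernel are nonnegative, so is
its integral against `μ × μ` for every probability measure `μ`: average the sums over independent
samples from `μ`. -/
theorem integral_prod_nonneg_of_sum_nonneg (μ : Measure ℝ) [IsProbabilityMeasure μ]
    {k : ℝ → ℝ → ℝ} (hk : Continuous fun p : ℝ × ℝ => k p.1 p.2) {C : ℝ} (hC : ∀ x y, |k x y| ≤ C)
    (hsum : ∀ (n : ℕ) (x : Fin n → ℝ), 0 ≤ ∑ i, ∑ j, k (x i) (x j)) :
    0 ≤ ∫ p, k p.1 p.2 ∂(μ.prod μ) := by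
  set I := ∫ p, k p.1 p.2 ∂(μ.prod μ)
  have hbound (n : ℕ) : 0 ≤ C + n * I := by
    have hcont (i j : Fin (n + 1)) : Continuous fun x : Fin (n + 1) → ℝ => k (x i) (x j) :=
      hk.comp (f := fun x : Fin (n + 1) → ℝ => (x i, x j))
        ((continuous_apply i).prodMk (continuous_apply j))
    have hint (i j : Fin (n + 1)) : Integrable (fun x : Fin (n + 1) → ℝ => k (x i) (x j))
        (Measure.pi fun _ => μ) :=
      .of_bound (hcont i j).aestronglyMeasurable C (.of_forall fun x => hC _ _)
    have hpos : 0 ≤ ∫ x, ∑ i, ∑ j, k (x i) (x j) ∂(Measure.pi fun _ : Fin (n + 1) => μ) :=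
      integral_nonneg fun x => hsum _ x
    rw [integral_finsetSum _ fun i _ => integrable_finsetSum _ fun j _ => hint i j] at hpos
    simp_rw [integral_finsetSum _ fun j _ => hint _ j] at hpos
    have hrow (i : Fin (n + 1)) :
        ∑ j, ∫ x, k (x i) (x j) ∂(Measure.pi fun _ : Fin (n + 1) => μ) ≤ C + n * I := by
      rw [← Finset.add_sum_erase _ _ (Finset.mem_univ i), Finset.sum_congr rfl fun j hj =>
        integral_pi_eval_eval μ hk (Finset.ne_of_mem_erase hj).symm]
      have hdiag : ∫ x, k (x i) (x i) ∂(Measure.pi fun _ : Fin (n + 1) => μ) ≤ C := by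
        simpa using integral_mono (hint i i) (integrable_const C) fun x => (abs_le.1 (hC _ _)).2
      simpa [I] using hdiag
    have htotal := hpos.trans (Finset.sum_le_sum fun i _ => hrow i)
    simp only [Finset.sum_const, Finset.card_univ, Fintype.card_fin, nsmul_eq_mul] at htotal
    exact nonneg_of_mul_nonneg_right htotal (by positivity)
  by_contra! hI
  obtain ⟨n, hn⟩ := exists_nat_gt (C / -I)
  rw [div_lt_iff₀ (by linarith)] at hn
  linarith [hbound n]

theorem integral_nonneg_of_sum_nonneg {g : ℝ → ℝ} (hg : Continuous g) (hgi : Integrable g) {C : ℝ}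
    (hC : ∀ x, |g x| ≤ C)
    (hsum : ∀ (n : ℕ) (x : Fin n → ℝ), 0 ≤ ∑ i, ∑ j, g (x i - x j)) :
    0 ≤ ∫ x, g x := by
  let F (T x : ℝ) : ℝ := ∫ u in (T * x - T)..(T * x), g u
  have hF (T : ℝ) (hT : 0 < T) : 0 ≤ ∫ x in (0 : ℝ)..1, F T x := by
    let μ : Measure ℝ := volume.restrict (Set.Ioc 0 1)
    have : IsProbabilityMeasure μ := ⟨by simp [μ]⟩
    have hk : Continuous fun p : ℝ × ℝ => g (T * p.1 - T * p.2) := by fun_prop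
    have hnonneg := integral_prod_nonneg_of_sum_nonneg μ
      (k := fun x y => g (T * x - T * y)) hk (fun _ _ => hC _) fun n x => hsum n fun i => T * x i
    rw [integral_prod _ (.of_bound hk.aestronglyMeasurable C (.of_forall fun _ => hC _))] at hnonneg
    have heq (x : ℝ) : F T x = T * ∫ y, g (T * x - T * y) ∂μ := by
      rw [← intervalIntegral.integral_of_le zero_le_one,
        intervalIntegral.integral_comp_sub_mul _ hT.ne']
      simp [F, hT.ne']
    simp_rw [heq]
    rw [intervalIntegral.integral_const_mul, intervalIntegral.integral_of_le zero_le_one]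
    exact mul_nonneg hT.le hnonneg
  have hlim : Tendsto (fun T => ∫ x in (0 : ℝ)..1, F T x) atTop
      (𝓝 (∫ _ in (0 : ℝ)..1, ∫ u, g u)) := by
    refine intervalIntegral.tendsto_integral_filter_of_dominated_convergence
      (fun _ => ∫ u, |g u|) (.of_forall fun T => ?_) (.of_forall fun T => .of_forall fun x _ => ?_)
      (by simp) ?_
    · have hcont : Continuous (F T) := by
        have hprim := intervalIntegral.continuous_primitive
          (fun a b => hg.intervalIntegrable (μ := volume) a b) 0
        have : F T = fun x => (∫ u in (0 : ℝ)..(T * x), g u) - ∫ u in (0 : ℝ)..(T * x - T), g u := by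
          ext x
          rw [intervalIntegral.integral_interval_sub_left] <;> exact hg.intervalIntegrable _ _
        rw [this]
        exact (hprim.comp (by fun_prop)).sub (hprim.comp (by fun_prop))
      exact hcont.aestronglyMeasurable
    · exact intervalIntegral.norm_integral_le_integral_norm_uIoc.trans
        (setIntegral_le_integral hgi.norm (.of_forall fun _ => norm_nonneg _))
    · filter_upwards [Measure.ae_ne volume (1 : ℝ)] with x hx1 hx
      rw [Set.uIoc_of_le zero_le_one] at hx
      have hlt : x - 1 < 0 := by linarith [lt_of_le_of_ne hx.2 hx1]
      refine intervalIntegral_tendsto_integral hgi ?_ (tendsto_id.atTop_mul_const hx.1)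
      simpa [mul_sub] using tendsto_id.atTop_mul_const_of_neg hlt
  simpa using ge_of_tendsto hlim ((eventually_gt_atTop 0).mono hF)

theorem evenPart_le_chi {H : ℝ → ℝ} {A B ℓ : ℝ}
    (hbound : ∀ x : ℝ, H x ≤ A * chi (-1) 1 x - B * chi (-ℓ) ℓ x) (x : ℝ) :
    evenPart H x ≤ A * chi (-1) 1 x - B * chi (-ℓ) ℓ x := by
  have hchi (a : ℝ) : chi (-a) a (-x) = chi (-a) a x := by
    simp only [chi, Set.mem_Icc, neg_le_neg_iff, neg_le (a := x), and_comm]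
  have hneg := hbound (-x)
  rw [hchi, hchi] at hneg
  rw [evenPart]
  linarith [hbound x]

theorem mul_chi_eq_indicator (f : ℝ → ℝ) (s t : ℝ) :
    (fun x => f x * chi s t x) = (Set.Icc s t).indicator f := by
  ext x
  simp [chi, Set.indicator_apply]

theorem integrable_mul_chi {f : ℝ → ℝ} (hf : Continuous f) (s t : ℝ) :
    Integrable fun x => f x * chi s t x := by
  rw [mul_chi_eq_indicator, integrable_indicator_iff measurableSet_Icc]
  exact hf.continuousOn.integrableOn_Icc

theorem integral_mul_chi (f : ℝ → ℝ) {s t : ℝ} (hst : s ≤ t) :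
    ∫ x, f x * chi s t x = ∫ x in s..t, f x := by
  rw [mul_chi_eq_indicator, integral_indicator measurableSet_Icc, integral_Icc_eq_integral_Ioc,
    intervalIntegral.integral_of_le hst]

theorem auxiliary_function_central (ℓ : ℝ) (hℓ : 0 < ℓ) (A B : ℝ) (H : ℝ → ℝ)
    (hHc : Continuous H) (hHi : Integrable H) (hHpd : IsPosDefFn H)
    (hbound : ∀ x : ℝ, H x ≤ A * chi (-1) 1 x - B * chi (-ℓ) ℓ x)
    (f : ℝ → ℝ) (hf : Continuous f) (hdp : IsDoublyPos f) :
    B * ∫ x in (-ℓ)..ℓ, f x ≤ A * ∫ x in (-1 : ℝ)..1, f x := by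
  obtain ⟨hfpd, hf0⟩ := hdp
  have hfe := continuous_evenPart hf
  have hint : Integrable fun x => evenPart f x * evenPart H x :=
    (integrable_evenPart hHi).bdd_mul hfe.aestronglyMeasurable (.of_forall hfpd.abs_evenPart_le)
  have hnonneg : 0 ≤ ∫ x, evenPart f x * evenPart H x := by
    refine integral_nonneg_of_sum_nonneg (hfe.mul (continuous_evenPart hHc)) hint
      (C := f 0 * H 0) (fun x => ?_) fun n x => hfpd.sum_evenPart_mul_evenPart_nonneg hHpd x
    rw [abs_mul]
    exact mul_le_mul (hfpd.abs_evenPart_le x) (hHpd.abs_evenPart_le x) (abs_nonneg _) (hf0 0)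
  have hA := (integrable_mul_chi hfe (-1) 1).const_mul A
  have hB := (integrable_mul_chi hfe (-ℓ) ℓ).const_mul B
  have hle : ∫ x, evenPart f x * evenPart H x ≤
      ∫ x, (A * (evenPart f x * chi (-1) 1 x) - B * (evenPart f x * chi (-ℓ) ℓ x)) := by
    refine integral_mono hint (hA.sub hB) fun x => ?_
    have hfx : 0 ≤ evenPart f x := div_nonneg (add_nonneg (hf0 _) (hf0 _)) zero_le_two
    exact (mul_le_mul_of_nonneg_left (evenPart_le_chi hbound x) hfx).trans_eq (by ring)
  rw [integral_sub hA hB, integral_const_mul, integral_const_mul,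
    integral_mul_chi _ (by norm_num), integral_mul_chi _ (by linarith),
    intervalIntegral_evenPart hf, intervalIntegral_evenPart hf] at hle
  linarith
end
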